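/- For every type-B composition α of n, the poset Tam_B(α) = (H_α(231), ≤), ordered by inclusion of inversion sets, is a lattice: every pair of its elements has a greatest lower bound and a least upper bound within H_α(231). -/

import Mathlib

namespace TypeB

/-- A sign-symmetric permutation of degree `n`: a bijection of `ℤ` with
`π(-i) = -π(i)` which fixes every integer of absolute value `> n`.
It restricts to a sign-symmetric permutation of `±[n]`. -/
structure SignedPerm (n : ℕ) where
  perm : Equiv.Perm ℤ
  sign_symm : ∀ i : ℤ, perm (-i) = - perm i
  outside : ∀ i : ℤ, (n : ℤ) < |i| → perm i = i

/-- Symbols for type-B inversions: `neg i` is `[i]`, `pair i j` (with `i < j`)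
is `(i,j)`, and `mixed i j` (with `i < j`) is `(−j, i)`. -/
inductive BInv (n : ℕ) : Type where
  | neg : ℕ → BInv n
  | pair : ℕ → ℕ → BInv n
  | mixed : ℕ → ℕ → BInv n
deriving DecidableEq

/-- `i⁺`: `i+1` if `i ≠ -1`, and `1` for `i = -1`. -/
def iplus (i : ℤ) : ℤ := if i = -1 then 1 else i + 1

/-- The inversion set of a sign-symmetric permutation. -/
def Inv {n : ℕ} (π : SignedPerm n) : Set (BInv n) := fun t =>
  match t with
  | .neg i => 1 ≤ i ∧ i ≤ n ∧ π.perm (i : ℤ) < 0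
  | .pair i j => 1 ≤ i ∧ i < j ∧ j ≤ n ∧ π.perm (j : ℤ) < π.perm (i : ℤ)
  | .mixed i j => 1 ≤ i ∧ i < j ∧ j ≤ n ∧ π.perm (i : ℤ) + π.perm (j : ℤ) < 0

/-- The cover-inversion set of a sign-symmetric permutation. -/
def Cov {n : ℕ} (π : SignedPerm n) : Set (BInv n) := fun t =>
  match t with
  | .neg i => 1 ≤ i ∧ i ≤ n ∧ π.perm (i : ℤ) = -1
  | .pair i j => 1 ≤ i ∧ i < j ∧ j ≤ n ∧ π.perm (i : ℤ) = iplus (π.perm (j : ℤ))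
  | .mixed i j => 1 ≤ i ∧ i < j ∧ j ≤ n ∧ π.perm (-(j : ℤ)) = iplus (π.perm (i : ℤ))

/-- The symbol `(−j, i)` in canonical form (it equals `(−i, j)`). -/
def mixedInv {n : ℕ} (i j : ℕ) : BInv n := .mixed (min i j) (max i j)

/-- A type-B composition of `n`: positive parts summing to `n`,
together with a split/join label. -/
structure BComp (n : ℕ) where
  parts : List ℕ
  pos : ∀ a ∈ parts, 0 < a
  sum_eq : parts.sum = n
  isJoin : Bool

/-- The partial sum `p_i = α₁ + ⋯ + α_i`. -/
def pSum {n : ℕ} (α : BComp n) (i : ℕ) : ℕ := (α.parts.take i).sum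

/-- The α-region of `a ∈ [n]`: the unique `i` with `p_{i-1} < a ≤ p_i`. -/
def region {n : ℕ} (α : BComp n) (a : ℕ) : ℕ :=
  ((Finset.range α.parts.length).filter (fun j => pSum α j < a)).card

/-- The first part `α₁` of a type-B composition. -/
def alpha1 {n : ℕ} (α : BComp n) : ℕ := α.parts.headI

/-- Index of the block of `Part(α)` containing `x ∈ ±[n]`; two elements lie in
a common block of `Part(α)` iff their indices agree. -/
def blockIdx {n : ℕ} (α : BComp n) (x : ℤ) : ℤ :=
  if 0 < x then
    (if α.isJoin = true ∧ region α x.toNat = 1 then 0 else (region α x.toNat : ℤ))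
  else
    (if α.isJoin = true ∧ region α (-x).toNat = 1 then 0 else -(region α (-x).toNat : ℤ))

/-- Membership in `±[n]`. -/
def inPM (n : ℕ) (x : ℤ) : Prop := x ≠ 0 ∧ -(n : ℤ) ≤ x ∧ x ≤ (n : ℤ)

/-- `π ∈ H_α`: `π` is increasing on every block of `Part(α)`. -/
def memH {n : ℕ} (α : BComp n) (π : SignedPerm n) : Prop :=
  ∀ a b : ℤ, inPM n a → inPM n b → a < b → blockIdx α a = blockIdx α b →
    π.perm a < π.perm b

/-- Common part of the type-B `(α,231)`- and `(α,312)`-patterns: indices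
`i < j < k` in `±[n]`, in pairwise distinct blocks of `Part(α)`, with `j > 0`
and `π(i) = π(k)⁺`. -/
def patternCore {n : ℕ} (α : BComp n) (π : SignedPerm n) (i j k : ℤ) : Prop :=
  inPM n i ∧ inPM n j ∧ inPM n k ∧ i < j ∧ j < k ∧ 0 < j ∧
  blockIdx α i ≠ blockIdx α j ∧ blockIdx α j ≠ blockIdx α k ∧
  blockIdx α i ≠ blockIdx α k ∧ π.perm i = iplus (π.perm k)

/-- `π` has a type-B `(α,231)`-split (resp. -join) pattern, according to the
label of `α`. -/
def has231 {n : ℕ} (α : BComp n) (π : SignedPerm n) : Prop :=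
  ∃ i j k : ℤ, patternCore α π i j k ∧
    (if α.isJoin = true then
       (((alpha1 α : ℤ) < j → π.perm i < π.perm j) ∧
        (j ≤ (alpha1 α : ℤ) → π.perm j < π.perm k))
     else π.perm i < π.perm j)

/-- `π` has a type-B `(α,312)`-split (resp. -join) pattern, according to the
label of `α`. -/
def has312 {n : ℕ} (α : BComp n) (π : SignedPerm n) : Prop :=
  ∃ i j k : ℤ, patternCore α π i j k ∧
    (if α.isJoin = true then
       (((alpha1 α : ℤ) < j → π.perm j < π.perm k) ∧
        (j ≤ (alpha1 α : ℤ) → π.perm i < π.perm j))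
     else π.perm j < π.perm k)

/-- `π ∈ H_α(231)`. -/
def mem231 {n : ℕ} (α : BComp n) (π : SignedPerm n) : Prop := memH α π ∧ ¬ has231 α π

/-- `π ∈ H_α(312)`. -/
def mem312 {n : ℕ} (α : BComp n) (π : SignedPerm n) : Prop := memH α π ∧ ¬ has312 α π

/-- The set `H_α`. -/
def Hset {n : ℕ} (α : BComp n) : Set (SignedPerm n) := {π | memH α π}

/-- The carrier of `Tam_B(α)`, namely `H_α(231)`. -/
def Tset {n : ℕ} (α : BComp n) : Set (SignedPerm n) := {π | mem231 α π}

/-- The weak order: inclusion of inversion sets. -/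
def wle {n : ℕ} (π σ : SignedPerm n) : Prop := Inv π ⊆ Inv σ

/-- `m` is the greatest lower bound of `x` and `y` within `P`, w.r.t. the weak order. -/
def isMeetIn {n : ℕ} (P : Set (SignedPerm n)) (x y m : SignedPerm n) : Prop :=
  m ∈ P ∧ wle m x ∧ wle m y ∧ ∀ z ∈ P, wle z x → wle z y → wle z m

/-- `u` is the least upper bound of `x` and `y` within `P`, w.r.t. the weak order. -/
def isJoinIn {n : ℕ} (P : Set (SignedPerm n)) (x y u : SignedPerm n) : Prop :=
  u ∈ P ∧ wle x u ∧ wle y u ∧ ∀ z ∈ P, wle x z → wle y z → wle u z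

/-- `d = Π↓(π)`: `d` is the greatest element of `{σ ∈ H_α(231) : Inv σ ⊆ Inv π}`. -/
def isProjDown {n : ℕ} (α : BComp n) (π d : SignedPerm n) : Prop :=
  mem231 α d ∧ wle d π ∧ ∀ σ, mem231 α σ → wle σ π → wle σ d

/-- `d = Π†(π)`: `d` is the greatest element of `{σ ∈ H_α(312) : Inv σ ⊆ Inv π}`. -/
def isProjDagger {n : ℕ} (α : BComp n) (π d : SignedPerm n) : Prop :=
  mem312 α d ∧ wle d π ∧ ∀ σ, mem312 α σ → wle σ π → wle σ d

/-- The value `ω_{o;α}(a)` for `a ∈ [n]`. -/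
def omegaPos {n : ℕ} (α : BComp n) (a : ℕ) : ℤ :=
  if α.isJoin = true ∧ region α a = 1 then (a : ℤ)
  else -(((pSum α (region α a) : ℤ) + (pSum α (region α a - 1) : ℤ) + 1) - (a : ℤ))

/-- The longest element `ω_{o;α}` of `H_α`, as a function on `ℤ`. -/
def omegaFun {n : ℕ} (α : BComp n) (x : ℤ) : ℤ :=
  if 0 < x ∧ x ≤ (n : ℤ) then omegaPos α x.toNat
  else if 0 < -x ∧ -x ≤ (n : ℤ) then -(omegaPos α (-x).toNat)
  else x

/-- The set of `m` such that there is a strict chain `x₀ < x₁ < ⋯ < x_m` in `P`. -/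
def chainLengths {n : ℕ} (P : Set (SignedPerm n)) : Set ℕ :=
  {m | ∃ f : Fin (m + 1) → SignedPerm n, (∀ i, f i ∈ P) ∧
        ∀ i j : Fin (m + 1), i < j → Inv (f i) ⊂ Inv (f j)}

/-- `x` is join-irreducible in `Tam_B(α)`. -/
def joinIrred {n : ℕ} (α : BComp n) (x : SignedPerm n) : Prop :=
  x ∈ Tset α ∧ ¬ (∀ y ∈ Tset α, wle x y) ∧
  ∀ y z, y ∈ Tset α → z ∈ Tset α → isJoinIn (Tset α) y z x → x = y ∨ x = z

/-- `x` is meet-irreducible in `Tam_B(α)`. -/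
def meetIrred {n : ℕ} (α : BComp n) (x : SignedPerm n) : Prop :=
  x ∈ Tset α ∧ ¬ (∀ y ∈ Tset α, wle y x) ∧
  ∀ y z, y ∈ Tset α → z ∈ Tset α → isMeetIn (Tset α) y z x → x = y ∨ x = z

/-- `x` is left modular in the lattice on `P`: `(r ∨ x) ∧ q = r ∨ (x ∧ q)`
for all `r ≤ q` in `P`. -/
def leftModular {n : ℕ} (P : Set (SignedPerm n)) (x : SignedPerm n) : Prop :=
  ∀ r q, r ∈ P → q ∈ P → wle r q →
    ∀ u v w1 w2, isJoinIn P r x u → isMeetIn P u q v →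
      isMeetIn P x q w1 → isJoinIn P r w1 w2 → v = w2

/-- The simple generator `s_i` as a function on `ℤ`: `s₀` exchanges `1` and `-1`,
and for `i ≥ 1`, `s_i` exchanges `i` with `i+1` and `-i` with `-(i+1)`. -/
def sfun (i : ℕ) (x : ℤ) : ℤ :=
  if i = 0 then (if x = 1 then -1 else if x = -1 then 1 else x)
  else if x = (i : ℤ) then (i : ℤ) + 1
  else if x = (i : ℤ) + 1 then (i : ℤ)
  else if x = -(i : ℤ) then -(i : ℤ) - 1
  else if x = -(i : ℤ) - 1 then -(i : ℤ)
  else x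

/-- `i` is one of the partial sums `p₁, …, p_{r−1}` of `α`. -/
def isPSum {n : ℕ} (α : BComp n) (i : ℕ) : Prop :=
  ∃ j : ℕ, 1 ≤ j ∧ j < α.parts.length ∧ pSum α j = i

/-- `n² − Σᵢ α_i(α_i−1)/2`, minus additionally `(α₁+1)α₁/2` when `α` is join. -/
def lengthFormula {n : ℕ} (α : BComp n) : ℕ :=
  n ^ 2 - (α.parts.map (fun a => a * (a - 1) / 2)).sum -
    (if α.isJoin = true then (alpha1 α + 1) * alpha1 α / 2 else 0)

section Basic

variable {n : ℕ}

theorem SignedPerm.map_zero (π : SignedPerm n) : π.perm 0 = 0 := by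
  have := π.sign_symm 0
  simp only [neg_zero] at this
  omega

theorem SignedPerm.abs_le (π : SignedPerm n) {a : ℤ} (ha : |a| ≤ n) : |π.perm a| ≤ n := by
  by_contra! h
  have := π.perm.injective (π.outside _ h)
  rw [this] at h
  omega

/-- The pair `a < b` of integers is inverted by `π`. -/
def Inverts (π : SignedPerm n) (a b : ℤ) : Prop := a < b ∧ π.perm b < π.perm a

theorem Inverts.neg {π : SignedPerm n} {a b : ℤ} (h : Inverts π a b) : Inverts π (-b) (-a) := by
  obtain ⟨h1, h2⟩ := h
  refine ⟨by omega, ?_⟩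
  rw [π.sign_symm, π.sign_symm]
  omega

theorem Inverts.bounds {π : SignedPerm n} {a b : ℤ} (h : Inverts π a b) :
    |a| ≤ n ∧ |b| ≤ n := by
  obtain ⟨h1, h2⟩ := h
  have ha : |a| ≤ n ∨ (|a| > n ∧ π.perm a = a) := by
    rcases le_or_gt |a| (n : ℤ) with h | h
    · exact .inl h
    · exact .inr ⟨h, π.outside a h⟩
  have hb : |b| ≤ n ∨ (|b| > n ∧ π.perm b = b) := by
    rcases le_or_gt |b| (n : ℤ) with h | h
    · exact .inl h
    · exact .inr ⟨h, π.outside b h⟩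
  have ha' := fun h => π.abs_le (a := a) h
  have hb' := fun h => π.abs_le (a := b) h
  simp only [_root_.abs_le, gt_iff_lt, lt_abs] at *
  grind

theorem inverts_of_wle {π σ : SignedPerm n} (h : wle π σ) {a b : ℤ} (hab : Inverts π a b) :
    Inverts σ a b := by
  have key : ∀ a b : ℤ, -b ≤ a → Inverts π a b → Inverts σ a b := by
    intro a b hle hab
    have hbd := hab.bounds
    simp only [_root_.abs_le] at hbd
    obtain ⟨hlt, hinv⟩ := hab
    refine ⟨hlt, ?_⟩
    lift b to ℕ using by omega
    rcases lt_trichotomy a 0 with ha | rfl | ha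
    · obtain ⟨c, rfl⟩ : ∃ c : ℕ, a = -(c : ℤ) := ⟨a.natAbs, by omega⟩
      rw [π.sign_symm] at hinv
      rw [σ.sign_symm]
      rcases lt_or_eq_of_le hle with hlt' | heq
      · have : BInv.mixed c b ∈ Inv π := ⟨by omega, by omega, by omega, by omega⟩
        obtain ⟨-, -, -, h4⟩ := h this
        omega
      · obtain rfl : b = c := by omega
        have : BInv.neg b ∈ Inv π := ⟨by omega, by omega, by omega⟩
        obtain ⟨-, -, h4⟩ := h this
        omega
    · rw [π.map_zero] at hinv
      rw [σ.map_zero]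
      have : BInv.neg b ∈ Inv π := ⟨by omega, by omega, by omega⟩
      exact (h this).2.2
    · lift a to ℕ using by omega
      have : BInv.pair a b ∈ Inv π := ⟨by omega, by omega, by omega, hinv⟩
      exact (h this).2.2.2
  by_cases hle : -b ≤ a
  · exact key a b hle hab
  · simpa using (key (-b) (-a) (by omega) hab.neg).neg

theorem wle_of_inverts {π σ : SignedPerm n}
    (h : ∀ a b, Inverts π a b → Inverts σ a b) : wle π σ := by
  intro t ht
  match t, ht with
  | .neg i, ht =>
    obtain ⟨h1, h2, h3⟩ := ht
    have := (h 0 i ⟨by omega, by rwa [π.map_zero]⟩).2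
    rw [σ.map_zero] at this
    exact ⟨h1, h2, this⟩
  | .pair i j, ht =>
    obtain ⟨h1, h2, h3, h4⟩ := ht
    exact ⟨h1, h2, h3, (h i j ⟨by omega, h4⟩).2⟩
  | .mixed i j, ht =>
    obtain ⟨h1, h2, h3, h4⟩ := ht
    have := (h (-i) j ⟨by omega, by rw [π.sign_symm]; omega⟩).2
    rw [σ.sign_symm] at this
    exact ⟨h1, h2, h3, by omega⟩

end Basic

section Rank

variable {n : ℕ}

/-- A relation on the integers which is the set of inverted pairs of some signed permutation. -/
structure IsInversionRel (n : ℕ) (R : ℤ → ℤ → Prop) : Prop where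
  lt : ∀ a b, R a b → a < b
  bounds : ∀ a b, R a b → |a| ≤ n ∧ |b| ≤ n
  neg : ∀ a b, R a b → R (-b) (-a)
  trans : ∀ a b c, R a b → R b c → R a c
  cotrans : ∀ a b c, a < b → b < c → R a c → R a b ∨ R b c

/-- The total order in which exactly the pairs of `R` are reversed. -/
def reorder (R : ℤ → ℤ → Prop) (a b : ℤ) : Prop := (a < b ∧ ¬ R a b) ∨ (b < a ∧ R b a)

namespace IsInversionRel

variable {R : ℤ → ℤ → Prop}

theorem reorder_irrefl (a : ℤ) : ¬ reorder R a a := by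
  unfold reorder; omega

theorem reorder_total {a b : ℤ} (h : a ≠ b) : reorder R a b ∨ reorder R b a := by
  unfold reorder
  rcases lt_or_gt_of_ne h with h | h <;> tauto

theorem reorder_trans (hR : IsInversionRel n R) {a b c : ℤ} (hab : reorder R a b)
    (hbc : reorder R b c) : reorder R a c := by
  unfold reorder at *
  have h1 := hR.lt
  have h2 := hR.trans
  have h3 := hR.cotrans
  rcases hab with ⟨hab, h⟩ | ⟨hab, h⟩ <;> rcases hbc with ⟨hbc, h'⟩ | ⟨hbc, h'⟩
  · have := h3 a b c hab hbc
    exact .inl ⟨by omega, by tauto⟩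
  · rcases lt_trichotomy a c with hac | rfl | hac
    · exact .inl ⟨hac, fun hR' => h (h2 _ _ _ hR' h')⟩
    · exact absurd h' h
    · exact .inr ⟨hac, (h3 c a b hac hab h').resolve_right h⟩
  · rcases lt_trichotomy a c with hac | rfl | hac
    · exact .inl ⟨hac, fun hR' => h' (h2 _ _ _ h hR')⟩
    · exact absurd h h'
    · exact .inr ⟨hac, (h3 b c a hbc hac h).resolve_left h'⟩
  · exact .inr ⟨by omega, h2 _ _ _ h' h⟩

theorem reorder_neg (hR : IsInversionRel n R) {a b : ℤ} (h : reorder R a b) :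
    reorder R (-b) (-a) := by
  unfold reorder at *
  rcases h with ⟨h, h'⟩ | ⟨h, h'⟩
  · refine .inl ⟨by omega, fun h2 => h' ?_⟩
    simpa using hR.neg _ _ h2
  · exact .inr ⟨by omega, hR.neg _ _ h'⟩

open Classical in
/-- The elements of `[-n, n]` preceding `a` in the order `reorder R`. -/
noncomputable def below (n : ℕ) (R : ℤ → ℤ → Prop) (a : ℤ) : Finset ℤ :=
  (Finset.Icc (-(n : ℤ)) n).filter fun b => reorder R b a

open Classical in
/-- The elements of `[-n, n]` following `a` in the order `reorder R`. -/
noncomputable def above (n : ℕ) (R : ℤ → ℤ → Prop) (a : ℤ) : Finset ℤ :=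
  (Finset.Icc (-(n : ℤ)) n).filter fun b => reorder R a b

theorem mem_below {a b : ℤ} : b ∈ below n R a ↔ (-(n : ℤ) ≤ b ∧ b ≤ n) ∧ reorder R b a := by
  simp [below]

theorem mem_above {a b : ℤ} : b ∈ above n R a ↔ (-(n : ℤ) ≤ b ∧ b ≤ n) ∧ reorder R a b := by
  simp [above]

theorem card_below_neg (hR : IsInversionRel n R) (a : ℤ) :
    (below n R (-a)).card = (above n R a).card := by
  apply Finset.card_bij (fun b _ => -b)
  · intro b hb
    rw [mem_below] at hb
    rw [mem_above]
    exact ⟨by omega, by simpa using hR.reorder_neg hb.2⟩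
  · intro b _ c _ h
    omega
  · intro b hb
    rw [mem_above] at hb
    refine ⟨-b, ?_, by omega⟩
    rw [mem_below]
    exact ⟨by omega, hR.reorder_neg hb.2⟩

theorem card_below_add_above (hR : IsInversionRel n R) {a : ℤ} (ha : -(n : ℤ) ≤ a ∧ a ≤ n) :
    (below n R a).card + (above n R a).card = 2 * n := by
  rw [← Finset.card_union_of_disjoint]
  · have : below n R a ∪ above n R a = (Finset.Icc (-(n : ℤ)) n).erase a := by
      ext b
      simp only [Finset.mem_union, mem_below, mem_above, Finset.mem_erase, Finset.mem_Icc]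
      constructor
      · rintro (⟨h, h'⟩ | ⟨h, h'⟩)
        · exact ⟨fun e => reorder_irrefl a (e ▸ h'), h⟩
        · exact ⟨fun e => reorder_irrefl a (e ▸ h'), h⟩
      · rintro ⟨h, h'⟩
        rcases reorder_total (R := R) h with h | h
        · exact .inl ⟨h', h⟩
        · exact .inr ⟨h', h⟩
    rw [this, Finset.card_erase_of_mem (by simpa using ha), Int.card_Icc]
    omega
  · rw [Finset.disjoint_left]
    intro b hb hb'
    rw [mem_below] at hb
    rw [mem_above] at hb'
    exact reorder_irrefl _ (hR.reorder_trans hb.2 hb'.2)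

theorem card_below_lt (hR : IsInversionRel n R) {a b : ℤ} (ha : -(n : ℤ) ≤ a ∧ a ≤ n)
    (h : reorder R a b) : (below n R a).card < (below n R b).card := by
  apply Finset.card_lt_card
  rw [Finset.ssubset_iff_of_subset]
  · exact ⟨a, mem_below.2 ⟨ha, h⟩, fun h' => reorder_irrefl _ (mem_below.1 h').2⟩
  · intro c hc
    rw [mem_below] at hc ⊢
    exact ⟨hc.1, hR.reorder_trans hc.2 h⟩

/-- The position of `a` in the order `reorder R`, shifted to take values in `[-n, n]`. -/
noncomputable def rank (n : ℕ) (R : ℤ → ℤ → Prop) (a : ℤ) : ℤ :=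
  if -(n : ℤ) ≤ a ∧ a ≤ n then (below n R a).card - n else a

theorem rank_mem (hR : IsInversionRel n R) {a : ℤ} (ha : -(n : ℤ) ≤ a ∧ a ≤ n) :
    -(n : ℤ) ≤ rank n R a ∧ rank n R a ≤ n := by
  have := hR.card_below_add_above ha
  rw [rank, if_pos ha]
  omega

theorem rank_lt (hR : IsInversionRel n R) {a b : ℤ} (ha : -(n : ℤ) ≤ a ∧ a ≤ n)
    (hb : -(n : ℤ) ≤ b ∧ b ≤ n) (h : reorder R a b) : rank n R a < rank n R b := by
  have := hR.card_below_lt ha h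
  rw [rank, rank, if_pos ha, if_pos hb]
  omega

theorem rank_neg (hR : IsInversionRel n R) (a : ℤ) : rank n R (-a) = -rank n R a := by
  by_cases ha : -(n : ℤ) ≤ a ∧ a ≤ n
  · have h1 := hR.card_below_neg a
    have h2 := hR.card_below_add_above ha
    rw [rank, rank, if_pos ha, if_pos (by omega)]
    omega
  · rw [rank, rank, if_neg ha, if_neg (by omega)]

theorem rank_injective (hR : IsInversionRel n R) : Function.Injective (rank n R) := by
  intro a b hab
  by_contra hne
  by_cases ha : -(n : ℤ) ≤ a ∧ a ≤ n <;> by_cases hb : -(n : ℤ) ≤ b ∧ b ≤ n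
  · rcases reorder_total (R := R) hne with h | h
    · have := hR.rank_lt ha hb h
      omega
    · have := hR.rank_lt hb ha h
      omega
  · have := hR.rank_mem ha
    have h' : rank n R b = b := if_neg hb
    omega
  · have := hR.rank_mem hb
    have h' : rank n R a = a := if_neg ha
    omega
  · have h' : rank n R a = a := if_neg ha
    have h'' : rank n R b = b := if_neg hb
    omega

theorem rank_surjective (hR : IsInversionRel n R) : Function.Surjective (rank n R) := by
  intro b
  by_cases hb : -(n : ℤ) ≤ b ∧ b ≤ n
  · have := Finset.surjOn_of_injOn_of_card_le (s := Finset.Icc (-(n : ℤ)) n)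
      (t := Finset.Icc (-(n : ℤ)) n) (rank n R)
      (fun a ha => by
        simp only [Finset.coe_Icc, Set.mem_Icc] at ha ⊢
        exact hR.rank_mem ha)
      hR.rank_injective.injOn le_rfl
    obtain ⟨a, -, ha⟩ := this (by simpa using hb)
    exact ⟨a, ha⟩
  · exact ⟨b, if_neg hb⟩

theorem exists_signedPerm (hR : IsInversionRel n R) :
    ∃ π : SignedPerm n, ∀ a b, Inverts π a b ↔ R a b := by
  have hbij : Function.Bijective (rank n R) := ⟨hR.rank_injective, hR.rank_surjective⟩
  refine ⟨⟨Equiv.ofBijective _ hbij, hR.rank_neg, ?_⟩, ?_⟩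
  · intro i hi
    rw [Equiv.ofBijective_apply, rank, if_neg]
    rw [lt_abs] at hi
    omega
  · intro a b
    constructor
    · intro h
      have hbd := h.bounds
      simp only [abs_le] at hbd
      obtain ⟨h1, h2⟩ := h
      by_contra hab
      have := hR.rank_lt hbd.1 hbd.2 (.inl ⟨h1, hab⟩)
      simp only [Equiv.ofBijective_apply] at h2
      omega
    · intro h
      have hbd := hR.bounds _ _ h
      simp only [abs_le] at hbd
      exact ⟨hR.lt _ _ h, hR.rank_lt hbd.2 hbd.1 (.inr ⟨hR.lt _ _ h, h⟩)⟩

end IsInversionRel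

end Rank

section WeakJoin

variable {n : ℕ}

/-- The pair `a < b` is inverted by some member of `S`. -/
def InvertsSome (S : Set (SignedPerm n)) (a b : ℤ) : Prop := ∃ x ∈ S, Inverts x a b

theorem isInversionRel_transGen (S : Set (SignedPerm n)) :
    IsInversionRel n (Relation.TransGen (InvertsSome S)) where
  lt a b h := by
    induction h with
    | single h => exact h.choose_spec.2.1
    | tail _ h ih => exact ih.trans h.choose_spec.2.1
  bounds a b h := by
    induction h with
    | single h => exact h.choose_spec.2.bounds
    | tail _ h ih => exact ⟨ih.1, h.choose_spec.2.bounds.2⟩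
  neg a b h := by
    induction h with
    | single h => exact .single ⟨_, h.choose_spec.1, h.choose_spec.2.neg⟩
    | tail _ h ih => exact .head ⟨_, h.choose_spec.1, h.choose_spec.2.neg⟩ ih
  trans _ _ _ := .trans
  cotrans a b c hab hbc h := by
    have split : ∀ {a b c}, a < b → b < c → InvertsSome S a c →
        InvertsSome S a b ∨ InvertsSome S b c := by
      rintro a b c hab hbc ⟨x, hx, -, h⟩
      rcases lt_or_ge (x.perm b) (x.perm a) with h' | h'
      · exact .inl ⟨x, hx, hab, h'⟩
      · exact .inr ⟨x, hx, hbc, by omega⟩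
    induction h with
    | single h => exact (split hab hbc h).imp .single .single
    | @tail m c hm h ih =>
      rcases lt_trichotomy b m with hb | rfl | hb
      · exact (ih hb).imp id fun h' => h'.tail h
      · exact .inl hm
      · exact (split hb hbc h).imp hm.tail .single

theorem exists_weakJoin (S : Set (SignedPerm n)) :
    ∃ z : SignedPerm n, ∀ a b, Inverts z a b ↔ Relation.TransGen (InvertsSome S) a b :=
  (isInversionRel_transGen S).exists_signedPerm

theorem wle_weakJoin {S : Set (SignedPerm n)} {z : SignedPerm n}
    (hz : ∀ a b, Inverts z a b ↔ Relation.TransGen (InvertsSome S) a b) {x : SignedPerm n}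
    (hx : x ∈ S) : wle x z :=
  wle_of_inverts fun a b h => (hz a b).2 (.single ⟨x, hx, h⟩)

theorem weakJoin_wle {S : Set (SignedPerm n)} {z : SignedPerm n}
    (hz : ∀ a b, Inverts z a b ↔ Relation.TransGen (InvertsSome S) a b) {w : SignedPerm n}
    (hw : ∀ x ∈ S, wle x w) : wle z w := by
  refine wle_of_inverts fun a b h => ?_
  rw [hz] at h
  induction h with
  | single h => exact inverts_of_wle (hw _ h.choose_spec.1) h.choose_spec.2
  | tail _ h ih =>
    have := inverts_of_wle (hw _ h.choose_spec.1) h.choose_spec.2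
    exact ⟨ih.1.trans this.1, this.2.trans ih.2⟩

/-- A cover inversion of the weak order join of `S` is an inversion of some member of `S`. -/
theorem invertsSome_of_cover {S : Set (SignedPerm n)} {z : SignedPerm n}
    (hz : ∀ a b, Inverts z a b ↔ Relation.TransGen (InvertsSome S) a b) {i k : ℤ} (hik : i < k)
    (hcov : z.perm i = iplus (z.perm k)) : InvertsSome S i k := by
  have h0 : z.perm 0 = 0 := z.map_zero
  have hinv : Inverts z i k := ⟨hik, by rw [hcov, iplus]; split_ifs <;> omega⟩
  rcases Relation.TransGen.tail'_iff.1 ((hz i k).1 hinv) with ⟨m, him, hmk⟩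
  rcases Relation.reflTransGen_iff_eq_or_transGen.1 him with rfl | him
  · exact hmk
  · have h1 := ((hz _ _).2 him).2
    have h2 := ((hz _ _).2 (.single hmk)).2
    have hval : z.perm k = -1 ∧ z.perm m = 0 := by
      rw [iplus] at hcov
      split_ifs at hcov <;> omega
    rw [iplus, if_pos hval.1] at hcov
    obtain rfl : m = 0 := z.perm.injective (by rw [hval.2, h0])
    obtain rfl : i = -k := z.perm.injective (by rw [z.sign_symm, hval.1, hcov]; rfl)
    obtain ⟨x, hx, hlt, hxk⟩ := hmk
    refine ⟨x, hx, by omega, ?_⟩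
    rw [x.sign_symm]
    rw [x.map_zero] at hxk
    omega

end WeakJoin

section Blocks

variable {n : ℕ}

theorem region_mono (α : BComp n) {a b : ℕ} (h : a ≤ b) : region α a ≤ region α b := by
  apply Finset.card_le_card
  intro j hj
  rw [Finset.mem_filter] at hj ⊢
  exact ⟨hj.1, hj.2.trans_le h⟩

theorem region_pos (hn : 1 ≤ n) (α : BComp n) {a : ℕ} (h : 1 ≤ a) : 1 ≤ region α a := by
  apply Finset.card_pos.2
  refine ⟨0, ?_⟩
  rw [Finset.mem_filter, Finset.mem_range]
  refine ⟨List.length_pos_iff.2 fun he => ?_, by simpa [pSum] using Nat.lt_of_succ_le h⟩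
  have := α.sum_eq
  simp only [he, List.sum_nil] at this
  omega

theorem blockIdx_mono (hn : 1 ≤ n) (α : BComp n) {a b : ℤ} (ha : a ≠ 0) (hb : b ≠ 0)
    (h : a ≤ b) : blockIdx α a ≤ blockIdx α b := by
  unfold blockIdx
  rcases lt_or_gt_of_ne ha with ha | ha <;> rcases lt_or_gt_of_ne hb with hb | hb
  · have h1 := region_mono α (show (-b).toNat ≤ (-a).toNat by omega)
    have h2 := region_pos hn α (show 1 ≤ (-b).toNat by omega)
    grind
  · have h1 := region_pos hn α (show 1 ≤ (-a).toNat by omega)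
    have h2 := region_pos hn α (show 1 ≤ b.toNat by omega)
    grind
  · omega
  · have h1 := region_mono α (show a.toNat ≤ b.toNat by omega)
    have h2 := region_pos hn α (show 1 ≤ a.toNat by omega)
    grind

theorem blockIdx_nonpos_of_neg (α : BComp n) {a : ℤ} (ha : a < 0) : blockIdx α a ≤ 0 := by
  unfold blockIdx
  grind

theorem blockIdx_neg (α : BComp n) {a : ℤ} (ha : a ≠ 0) : blockIdx α (-a) = -blockIdx α a := by
  unfold blockIdx
  rw [neg_neg]
  grind

theorem exists_iplus_step (p : ℤ → Prop) {a b : ℤ} (ha : a ≠ 0) (hb : b ≠ 0) (hab : a ≤ b)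
    (hpa : p a) (hpb : ¬ p b) :
    ∃ c, c ≠ 0 ∧ a ≤ c ∧ iplus c ≤ b ∧ p c ∧ ¬ p (iplus c) := by
  by_contra! hcon
  have key : ∀ d, a ≤ d → d ≤ b → p (if d = 0 then -1 else d) := by
    intro d had
    induction d, had using Int.leInduction with
    | base =>
      rw [if_neg ha]
      exact fun _ => hpa
    | succ d had ih =>
      intro hdb
      have ih := ih (by omega)
      rcases eq_or_ne d 0 with rfl | hd0
      · have := hcon (-1) (by omega) (by omega) (by rw [iplus]; omega) (by simpa using ih)
        simpa [iplus] using this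
      · rw [if_neg hd0] at ih
        rcases eq_or_ne d (-1) with rfl | hd1
        · simpa using ih
        · have hi : iplus d = d + 1 := if_neg hd1
          have := hcon d hd0 had (by rw [hi]; exact hdb) ih
          rwa [if_neg (by omega), ← hi]
  have := key b hab le_rfl
  rw [if_neg hb] at this
  exact hpb this

end Blocks

section Lattice

variable {n : ℕ}

theorem SignedPerm.map_ne_zero (π : SignedPerm n) {a : ℤ} (ha : a ≠ 0) : π.perm a ≠ 0 :=
  fun h => ha (π.perm.injective (by rw [h, π.map_zero]))

theorem SignedPerm.inPM_map (π : SignedPerm n) {a : ℤ} : inPM n (π.perm a) ↔ inPM n a := by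
  have h1 := π.map_zero
  have h2 := fun h => π.map_ne_zero (a := a) h
  have h3 := fun h => π.abs_le (a := a) h
  have h4 := fun h => π.outside a h
  simp only [inPM, _root_.abs_le, lt_abs] at *
  grind

/-- If every index strictly between `i` and `k` has its value under `x` outside the values from
`x k` to `x i`, then any such index `j` lies between the positions of a cover inversion of `x`
whose positions enclose `i, k` and whose values lie between those of `k` and `i`. -/
theorem exists_enclosing_cover (x : SignedPerm n) {i j k : ℤ} (hi : inPM n i) (hk : inPM n k)
    (hij : i < j) (hjk : j < k) (hinv : x.perm k < x.perm i)
    (hgap : ∀ m, m ≠ 0 → i < m → m < k → ¬ (x.perm k < x.perm m ∧ x.perm m < x.perm i)) :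
    ∃ i' k', inPM n i' ∧ inPM n k' ∧ i' ≤ i ∧ k ≤ k' ∧ x.perm i' ≤ x.perm i ∧
      x.perm k ≤ x.perm k' ∧ x.perm i' = iplus (x.perm k') := by
  obtain ⟨c, hc, hkc, hci, hpc, hpc'⟩ := exists_iplus_step (fun v => j < x.perm.symm v)
    (x.map_ne_zero hk.1) (x.map_ne_zero hi.1) hinv.le (by simpa using hjk) (by simp; omega)
  obtain ⟨k', rfl⟩ := x.perm.surjective c
  obtain ⟨i', hi'⟩ := x.perm.surjective (iplus (x.perm k'))
  rw [← hi'] at hci hpc'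
  simp only [Equiv.symm_apply_apply, not_lt] at hpc hpc'
  have hlt : x.perm k' < x.perm i' := by
    rw [hi', iplus]
    split_ifs <;> omega
  have hne : x.perm i' ≠ 0 := by
    rw [hi', iplus]
    split_ifs <;> omega
  have hi'0 : i' ≠ 0 := fun h => hne (by rw [h, x.map_zero])
  have hk'0 : k' ≠ 0 := fun h => hc (by rw [h, x.map_zero])
  have hxi := x.inPM_map.2 hi
  have hxk := x.inPM_map.2 hk
  unfold inPM at hxi hxk
  have hinj : ∀ a b, x.perm a = x.perm b → a = b := fun a b h => x.perm.injective h
  refine ⟨i', k', x.inPM_map.1 ⟨hne, by omega, by omega⟩,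
    x.inPM_map.1 ⟨hc, by omega, by omega⟩, ?_, ?_, hci, hkc, hi'⟩
  · by_contra! h
    have h1 := hgap i' hi'0 h (by omega)
    have h2 := hinj i' i
    omega
  · by_contra! h
    have h1 := hgap k' hk'0 (by omega) h
    have h2 := hinj k' k
    omega

theorem mem231_weakJoin (hn : 1 ≤ n) (α : BComp n) {S : Set (SignedPerm n)}
    (hS : ∀ x ∈ S, mem231 α x) {z : SignedPerm n}
    (hz : ∀ a b, Inverts z a b ↔ Relation.TransGen (InvertsSome S) a b) : mem231 α z := by
  have hle : ∀ x ∈ S, ∀ a b, Inverts x a b → Inverts z a b := fun x hx a b h =>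
    (hz a b).2 (.single ⟨x, hx, h⟩)
  constructor
  · intro a b ha hb hab hblk
    by_contra! h
    have hne : z.perm a ≠ z.perm b := fun h => hab.ne (z.perm.injective h)
    obtain ⟨m, ⟨x, hx, ham⟩, hmb⟩ :=
      Relation.TransGen.head'_iff.1 ((hz a b).1 ⟨hab, by omega⟩)
    have hmb : m ≤ b := by
      rcases Relation.reflTransGen_iff_eq_or_transGen.1 hmb with rfl | hmb
      · exact le_rfl
      · exact ((hz _ _).2 hmb).1.le
    have hinc : ∀ c, inPM n c → a < c → blockIdx α a = blockIdx α c → x.perm a < x.perm c :=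
      fun c hc hac h => (hS x hx).1 a c ha hc hac h
    rcases eq_or_ne m 0 with rfl | hm
    · have h1 := ham.1
      have h2 := ham.2
      have h3 := blockIdx_nonpos_of_neg α h1
      have h5 := blockIdx_neg α ha.1
      have h6 := blockIdx_nonpos_of_neg α (a := -b) (by have := hb.1; omega)
      have h7 := blockIdx_neg α hb.1
      have := hinc (-a) ⟨by omega, by have := ha.2; omega, by have := ha.2; omega⟩ (by omega)
        (by omega)
      rw [x.sign_symm] at this
      rw [x.map_zero] at h2
      omega
    · have hbd := ham.bounds.2
      rw [_root_.abs_le] at hbd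
      have h1 := blockIdx_mono hn α ha.1 hm ham.1.le
      have h2 := blockIdx_mono hn α hm hb.1 hmb
      have := hinc m ⟨hm, hbd⟩ ham.1 (by omega)
      exact this.not_gt ham.2
  · rintro ⟨i, j, k, ⟨hi, hj, hk, hij, hjk, hj0, hbij, hbjk, hbik, hcov⟩, hpat⟩
    obtain ⟨x, hx, -, hinv⟩ := invertsSome_of_cover hz (hij.trans hjk) hcov
    have hgap : ∀ m, m ≠ 0 → i < m → m < k →
        ¬ (x.perm k < x.perm m ∧ x.perm m < x.perm i) := by
      rintro m hm him hmk ⟨h1, h2⟩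
      have h3 := (hle x hx i m ⟨him, h2⟩).2
      have h4 := (hle x hx m k ⟨hmk, h1⟩).2
      have h5 := z.map_ne_zero hm
      rw [hcov, iplus] at h3
      split_ifs at h3 <;> omega
    obtain ⟨i', k', hi', hk', hii, hkk, hvi, hvk, hcov'⟩ :=
      exists_enclosing_cover x hi hk hij hjk hinv hgap
    have hm1 := blockIdx_mono hn α hi'.1 hi.1 hii
    have hm2 := blockIdx_mono hn α hi.1 hj.1 hij.le
    have hm3 := blockIdx_mono hn α hj.1 hk.1 hjk.le
    have hm4 := blockIdx_mono hn α hk.1 hk'.1 hkk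
    have hup : z.perm i < z.perm j → x.perm i' < x.perm j := by
      intro h
      by_contra! h'
      have h2 : x.perm j ≠ x.perm i := fun h => hij.ne' (x.perm.injective h)
      have := (hle x hx i j ⟨hij, by omega⟩).2
      omega
    have hdown : z.perm j < z.perm k → x.perm j < x.perm k' := by
      intro h
      by_contra! h'
      have h2 : x.perm j ≠ x.perm k := fun h => hjk.ne (x.perm.injective h)
      have := (hle x hx j k ⟨hjk, by omega⟩).2
      omega
    refine (hS x hx).2 ⟨i', j, k', ⟨hi', hj, hk', by omega, by omega, hj0, by omega, by omega,
      by omega, hcov'⟩, ?_⟩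
    split_ifs at hpat ⊢
    · exact ⟨fun h => hup (hpat.1 h), fun h => hdown (hpat.2 h)⟩
    · exact hup hpat

theorem exists_isLUB_wle (hn : 1 ≤ n) (α : BComp n) {S : Set (SignedPerm n)}
    (hS : ∀ x ∈ S, mem231 α x) :
    ∃ z, mem231 α z ∧ (∀ x ∈ S, wle x z) ∧ ∀ w, (∀ x ∈ S, wle x w) → wle z w := by
  obtain ⟨z, hz⟩ := exists_weakJoin S
  exact ⟨z, mem231_weakJoin hn α hS hz, fun x hx => wle_weakJoin hz hx,
    fun w hw => weakJoin_wle hz hw⟩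

end Lattice


/-- For every type-B composition `α` of `n`, the poset
`Tam_B(α)` on `H_α(231)`, ordered by inclusion of inversion sets, is a
lattice: every pair of its elements has a greatest lower bound and a least
upper bound within `H_α(231)`. -/
theorem tamB_is_lattice (n : ℕ) (hn : 1 ≤ n) (α : BComp n) :
    ∀ x y : SignedPerm n, mem231 α x → mem231 α y →
      (∃ m, isMeetIn (Tset α) x y m) ∧ (∃ u, isJoinIn (Tset α) x y u) := by
  intro x y hx hy
  constructor
  · obtain ⟨m, hm, hub, hleast⟩ := exists_isLUB_wle hn α
      (S := {z | mem231 α z ∧ wle z x ∧ wle z y}) fun z hz => hz.1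
    exact ⟨m, hm, hleast x fun z hz => hz.2.1, hleast y fun z hz => hz.2.2,
      fun z hz hzx hzy => hub z ⟨hz, hzx, hzy⟩⟩
  · obtain ⟨u, hu, hub, hleast⟩ := exists_isLUB_wle hn α (S := {x, y}) (by
      rintro z (rfl | rfl)
      exacts [hx, hy])
    refine ⟨u, hu, hub x (.inl rfl), hub y (.inr rfl), fun z _ hxz hyz => hleast z ?_⟩
    rintro w (rfl | rfl)
    exacts [hxz, hyz]

end TypeB
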